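/- Let α ∈ (0,1), M > 0 and ε ∈ (0,1). Then the two-sided NLR test φ_n^{ts} is asymptotically uniformly most powerful at level α on [−M, 0) ∪ (0, ∞): (i) limsup_{n→∞} ∫ φ_n^{ts}(y) dP^n_{θ0}(y) ≤ α, and (ii) for every sequence of measurable functions ψ_n : ℝ^n → [0,1] satisfying limsup_{n→∞} ∫ ψ_n dP^n_{θ0} ≤ α and every h ∈ [−M, 0) ∪ (0, ∞), liminf_{n→∞} ∫ φ_n^{ts}(y) dP^n_{θ0+h/n}(y) ≥ limsup_{n→∞} ∫ ψ_n dP^n_{θ0+h/n}. -/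

import Mathlib

open MeasureTheory Filter Real Topology

noncomputable section

attribute [local instance] Classical.propDecidable

/-- The benchmark nonregular model of Shimizu–Otsu, satisfying Assumption 1.
`f y θ` denotes the density kernel `f(y|θ)` and the data density is
`y ↦ f(y|θ) · 𝟙{y ≥ g θ}`. -/
structure BenchmarkModel where
  θ0 : ℝ
  /-- density kernel, `f y θ = f(y|θ)` -/
  f : ℝ → ℝ → ℝ
  /-- boundary function -/
  g : ℝ → ℝ
  /-- open neighborhood of `θ0` -/
  N : Set ℝ
  /-- uniform bound on `f` over `N` -/
  C : ℝ
  N_open : IsOpen N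
  θ0_mem : θ0 ∈ N
  /-- (a) `y ↦ f(y|θ)·𝟙{y ≥ g θ}` is a probability density for every `θ`. -/
  f_nonneg : ∀ θ y, g θ ≤ y → 0 ≤ f y θ
  f_integrable : ∀ θ, IntegrableOn (fun y => f y θ) (Set.Ici (g θ))
  f_density : ∀ θ, ∫ y in Set.Ici (g θ), f y θ = 1
  /-- (b) `θ ↦ f(y|θ)` is twice continuously differentiable for every `y`. -/
  f_smooth : ∀ y, ContDiff ℝ 2 fun θ => f y θ
  /-- (c) continuity in `y` for `θ ∈ N`, and uniform positive bounds on `N` -/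
  f_cont : ∀ θ ∈ N, Continuous fun y => f y θ
  fθ_cont : ∀ θ ∈ N, Continuous fun y => deriv (fun t => f y t) θ
  f_pos : ∀ θ ∈ N, ∀ y, 0 < f y θ
  f_lt : ∀ θ ∈ N, ∀ y, f y θ < C
  /-- (d) integrability of the suprema over `N` -/
  int1 : ∫⁻ y : ℝ, ⨆ θ ∈ N,
      ENNReal.ofReal (|deriv (fun t => f y t) θ| * if g θ ≤ y then 1 else 0) < ⊤
  int2 : ∫⁻ y : ℝ, ⨆ θ ∈ N, ⨆ θ' ∈ N, ENNReal.ofReal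
      ((deriv (fun t => f y t) θ') ^ 2 / (f y θ') ^ 2 *
        (if g θ ≤ y then 1 else 0) * f y θ) < ⊤
  int3 : ∫⁻ y : ℝ, ⨆ θ ∈ N, ⨆ θ' ∈ N, ENNReal.ofReal
      (|deriv (deriv fun t => f y t) θ'| / f y θ' *
        (if g θ ≤ y then 1 else 0) * f y θ) < ⊤
  /-- (e) conditions on `g` -/
  g_smooth : ContDiff ℝ 1 g
  g_deriv_pos : 0 < deriv g θ0
  g_deriv_bdd : ∃ B, ∀ θ ∈ N, |deriv g θ| ≤ B

namespace BenchmarkModel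

variable (M : BenchmarkModel)

/-- `λ = (f(g(θ0)|θ0)·g'(θ0))⁻¹`. -/
def lam : ℝ := (M.f (M.g M.θ0) M.θ0 * deriv M.g M.θ0)⁻¹

/-- The joint measure `P_θ^n` of an iid sample of size `n` on `ℝ^n`. -/
def P (n : ℕ) (θ : ℝ) : Measure (Fin n → ℝ) :=
  (volume : Measure (Fin n → ℝ)).withDensity fun y =>
    ENNReal.ofReal (∏ i, M.f (y i) θ * if M.g θ ≤ y i then 1 else 0)

/-- The likelihood-ratio statistic `Z_n(h, h̄)`. -/
def Z (n : ℕ) (h hb : ℝ) : (Fin n → ℝ) → ℝ := fun y =>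
  if ∀ i, M.g (M.θ0 + h / n) ≤ y i then
    (if ∀ i, M.g (M.θ0 + hb / n) ≤ y i then 1 else 0) *
      ∏ i, M.f (y i) (M.θ0 + hb / n) / M.f (y i) (M.θ0 + h / n)
  else 0

end BenchmarkModel

namespace BenchmarkModel

variable (M : BenchmarkModel)

/-- The two-sided NLR test with `h̄⁺ = −λ log α` and `h̄⁻ = −Mc`. -/
def phiTS (n : ℕ) (α Mc ε : ℝ) : (Fin n → ℝ) → ℝ := fun y =>
  if exp (-M.lam * Real.log α / M.lam) * (1 - ε) ≤ M.Z n 0 (-M.lam * Real.log α) y ∨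
      exp (-Mc / M.lam) * (1 + ε) < M.Z n 0 (-Mc) y ∨ ∃ i, y i < M.g M.θ0 then 1
  else 0

/-- The marginal density `y ↦ f(y|θ)·𝟙{y ≥ g θ}`. -/
def dens (θ y : ℝ) : ℝ := M.f y θ * if M.g θ ≤ y then 1 else 0

/-- The law of a single observation. -/
def law (θ : ℝ) : Measure ℝ := volume.withDensity fun y => ENNReal.ofReal (M.dens θ y)

/-- The score `∂θ log f(y|θ)`. -/
def score (y θ : ℝ) : ℝ := deriv (fun t => M.f y t) θ / M.f y θ

lemma dens_eq_indicator (θ : ℝ) :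
    M.dens θ = (Set.Ici (M.g θ)).indicator fun y => M.f y θ := by
  ext y
  by_cases h : M.g θ ≤ y <;> simp [dens, h]

lemma dens_nonneg (θ y : ℝ) : 0 ≤ M.dens θ y := by
  rw [dens_eq_indicator]
  exact Set.indicator_nonneg (fun y hy => M.f_nonneg θ y hy) y

lemma integrable_dens (θ : ℝ) : Integrable (M.dens θ) := by
  rw [dens_eq_indicator]
  exact (M.f_integrable θ).integrable_indicator measurableSet_Ici

lemma integral_dens (θ : ℝ) : ∫ y, M.dens θ y = 1 := by
  rw [dens_eq_indicator, integral_indicator measurableSet_Ici, M.f_density]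

instance (θ : ℝ) : IsProbabilityMeasure (M.law θ) := by
  constructor
  rw [law, withDensity_apply _ MeasurableSet.univ, Measure.restrict_univ,
    ← ofReal_integral_eq_lintegral_ofReal (M.integrable_dens θ)
      (Eventually.of_forall (M.dens_nonneg θ)), integral_dens, ENNReal.ofReal_one]

/-- A product density defines the product measure. -/
lemma pi_withDensity_ofReal {n : ℕ} {p : ℝ → ℝ} (hp : Integrable p) (hp0 : ∀ x, 0 ≤ p x)
    [SigmaFinite ((volume : Measure ℝ).withDensity fun x => ENNReal.ofReal (p x))] :
    Measure.pi (fun _ : Fin n => (volume : Measure ℝ).withDensity fun x => ENNReal.ofReal (p x)) =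
      (volume : Measure (Fin n → ℝ)).withDensity fun y => ENNReal.ofReal (∏ i, p (y i)) := by
  refine Measure.pi_eq fun s hs => ?_
  have hind : (Set.univ.pi s).indicator (fun y : Fin n → ℝ => ENNReal.ofReal (∏ i, p (y i))) =
      fun y => ENNReal.ofReal (∏ i, (s i).indicator p (y i)) := by
    ext y
    by_cases hy : y ∈ Set.univ.pi s
    · rw [Set.indicator_of_mem hy]
      congr 1
      exact Finset.prod_congr rfl fun i _ => (Set.indicator_of_mem (hy i trivial) p).symm
    · rw [Set.indicator_of_notMem hy]
      simp only [Set.mem_pi, Set.mem_univ, true_implies, not_forall] at hy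
      obtain ⟨i, hi⟩ := hy
      rw [Finset.prod_eq_zero (Finset.mem_univ i) (Set.indicator_of_notMem hi p),
        ENNReal.ofReal_zero]
  have hint : ∀ i, Integrable ((s i).indicator p) := fun i => hp.indicator (hs i)
  have hnn : ∀ i x, 0 ≤ (s i).indicator p x := fun i => Set.indicator_nonneg fun x _ => hp0 x
  rw [withDensity_apply _ (MeasurableSet.univ_pi hs),
    ← lintegral_indicator (MeasurableSet.univ_pi hs), hind,
    ← ofReal_integral_eq_lintegral_ofReal (μ := volume) (Integrable.fintype_prod hint)
      (Eventually.of_forall fun y => Finset.prod_nonneg fun i _ => hnn i _),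
    integral_fintype_prod_volume_eq_prod, ENNReal.ofReal_prod_of_nonneg
      fun i _ => integral_nonneg (hnn i)]
  refine Finset.prod_congr rfl fun i _ => ?_
  rw [withDensity_apply _ (hs i), integral_indicator (hs i),
    ofReal_integral_eq_lintegral_ofReal hp.integrableOn (Eventually.of_forall hp0)]

lemma P_eq_pi (n : ℕ) (θ : ℝ) : M.P n θ = Measure.pi fun _ => M.law θ := by
  have : IsProbabilityMeasure
      ((volume : Measure ℝ).withDensity fun y => ENNReal.ofReal (M.dens θ y)) :=
    inferInstanceAs (IsProbabilityMeasure (M.law θ))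
  exact (pi_withDensity_ofReal (M.integrable_dens θ) (M.dens_nonneg θ)).symm

instance (n : ℕ) (θ : ℝ) : IsProbabilityMeasure (M.P n θ) := by
  rw [P_eq_pi]; infer_instance

/-- The supremum over an open set of a jointly tame function has a measurable version. -/
lemma exists_measurable_majorant {D : Set ℝ} (hD : IsOpen D) {F : ℝ → ℝ → ℝ}
    (hm : ∀ θ ∈ D, Measurable fun y => F y θ) (hc : ∀ y, ContinuousOn (F y) D) :
    ∃ G : ℝ → ENNReal, Measurable G ∧ (∀ θ ∈ D, ∀ y, ENNReal.ofReal (F y θ) ≤ G y) ∧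
      ∀ y, G y ≤ ⨆ θ ∈ D, ENNReal.ofReal (F y θ) := by
  refine ⟨fun y => ⨆ q : ℚ, ⨆ _ : (q : ℝ) ∈ D, ENNReal.ofReal (F y q),
    Measurable.iSup fun q => ?_, fun θ hθ y => ?_, fun y => ?_⟩
  · by_cases hq : (q : ℝ) ∈ D
    · simpa only [hq, iSup_pos] using (hm _ hq).ennreal_ofReal
    · simpa only [hq, iSup_false] using measurable_const
  · have hcl : θ ∈ closure (D ∩ Set.range ((↑) : ℚ → ℝ)) :=
      hD.inter_closure ⟨hθ, Rat.denseRange_cast θ⟩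
    have hcw : ContinuousWithinAt (fun t => ENNReal.ofReal (F y t))
        (D ∩ Set.range ((↑) : ℚ → ℝ)) θ :=
      (ENNReal.continuous_ofReal.continuousAt.comp_continuousWithinAt (hc y θ hθ)).mono
        Set.inter_subset_left
    have : (𝓝[D ∩ Set.range ((↑) : ℚ → ℝ)] θ).NeBot := mem_closure_iff_nhdsWithin_neBot.1 hcl
    refine le_of_tendsto hcw ?_
    filter_upwards [self_mem_nhdsWithin] with t ht
    obtain ⟨htD, q, rfl⟩ := ht
    exact le_iSup₂_of_le q htD le_rfl
  · exact iSup₂_le fun q hq => le_iSup₂_of_le (q : ℝ) hq le_rfl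

lemma continuous_score_left {θ : ℝ} (hθ : θ ∈ M.N) : Continuous fun y => M.score y θ :=
  (M.fθ_cont θ hθ).div (M.f_cont θ hθ) fun y => (M.f_pos θ hθ y).ne'

lemma continuous_deriv_f (y : ℝ) : Continuous (deriv fun t => M.f y t) :=
  (M.f_smooth y).continuous_deriv (by norm_num)

lemma differentiable_f (y : ℝ) : Differentiable ℝ fun t => M.f y t :=
  (M.f_smooth y).differentiable (by norm_num)

lemma continuousOn_score (y : ℝ) : ContinuousOn (M.score y) M.N :=
  (M.continuous_deriv_f y).continuousOn.div (M.f_smooth y).continuous.continuousOn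
    fun θ hθ => (M.f_pos θ hθ y).ne'

lemma exists_score_majorant : ∃ G : ℝ → ENNReal, Measurable G ∧
    (∀ θ ∈ M.N, ∀ y, ENNReal.ofReal (M.score y θ ^ 2) ≤ G y) ∧
    ∀ θ ∈ M.N, ∫⁻ y in Set.Ici (M.g θ), G y * ENNReal.ofReal (M.f y θ) < ⊤ := by
  obtain ⟨G, hGm, hG, hG'⟩ := exists_measurable_majorant M.N_open
    (F := fun y θ => M.score y θ ^ 2)
    (fun θ hθ => ((M.continuous_score_left hθ).pow 2).measurable)
    (fun y => (M.continuousOn_score y).pow 2)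
  refine ⟨G, hGm, hG, fun θ hθ => lt_of_le_of_lt ?_ M.int2⟩
  rw [← lintegral_indicator measurableSet_Ici]
  refine lintegral_mono fun y => ?_
  by_cases hy : M.g θ ≤ y
  · rw [Set.indicator_of_mem (show y ∈ Set.Ici (M.g θ) from hy)]
    refine le_trans (mul_le_mul_left (hG' y) _) ?_
    simp only [ENNReal.iSup_mul]
    refine iSup₂_le fun θ' hθ' => ?_
    refine le_iSup₂_of_le θ hθ (le_iSup₂_of_le θ' hθ' ?_)
    rw [← ENNReal.ofReal_mul (sq_nonneg _), if_pos hy, mul_one, score, div_pow]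
  · rw [Set.indicator_of_notMem (show y ∉ Set.Ici (M.g θ) from hy)]
    exact zero_le

lemma exists_deriv_majorant {δ : ℝ} (hδ : Set.Ioo (M.θ0 - δ) (M.θ0 + δ) ⊆ M.N)
    (hg : StrictMonoOn M.g (Set.Ioo (M.θ0 - δ) (M.θ0 + δ))) (hδ0 : 0 < δ) :
    ∃ T : ℝ → ENNReal, Measurable T ∧
    (∀ θ ∈ Set.Ioo (M.θ0 - δ) M.θ0, ∀ y,
      ENNReal.ofReal |deriv (fun t => M.f y t) θ| ≤ T y) ∧
    ∫⁻ y in Set.Ici (M.g M.θ0), T y < ⊤ := by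
  have hsub : Set.Ioo (M.θ0 - δ) M.θ0 ⊆ Set.Ioo (M.θ0 - δ) (M.θ0 + δ) :=
    Set.Ioo_subset_Ioo_right (by linarith)
  obtain ⟨G, hGm, hG, hG'⟩ := exists_measurable_majorant (D := Set.Ioo (M.θ0 - δ) M.θ0)
    isOpen_Ioo (F := fun y θ => |deriv (fun t => M.f y t) θ|)
    (fun θ hθ => (M.fθ_cont θ (hδ (hsub hθ))).abs.measurable)
    (fun y => (M.continuous_deriv_f y).abs.continuousOn)
  refine ⟨G, hGm, hG, lt_of_le_of_lt ?_ M.int1⟩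
  rw [← lintegral_indicator measurableSet_Ici]
  refine lintegral_mono fun y => ?_
  by_cases hy : M.g M.θ0 ≤ y
  · rw [Set.indicator_of_mem (show y ∈ Set.Ici (M.g M.θ0) from hy)]
    refine le_trans (hG' y) (iSup₂_le fun θ hθ => ?_)
    have : M.g θ ≤ y :=
      (hg (hsub hθ) ⟨by linarith, by linarith⟩ hθ.2).le.trans hy
    refine le_iSup₂_of_le θ (hδ (hsub hθ)) ?_
    rw [if_pos this, mul_one]
  · rw [Set.indicator_of_notMem (show y ∉ Set.Ici (M.g M.θ0) from hy)]
    exact zero_le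

lemma exists_nhd : ∃ δ > 0, Set.Ioo (M.θ0 - δ) (M.θ0 + δ) ⊆ M.N ∧
    StrictMonoOn M.g (Set.Ioo (M.θ0 - δ) (M.θ0 + δ)) := by
  have hc : Continuous (deriv M.g) := M.g_smooth.continuous_deriv le_rfl
  have h1 : ∀ᶠ θ in 𝓝 M.θ0, θ ∈ M.N ∧ 0 < deriv M.g θ :=
    (M.N_open.eventually_mem M.θ0_mem).and (hc.continuousAt.eventually (lt_mem_nhds M.g_deriv_pos))
  obtain ⟨δ, hδ, h⟩ := Metric.eventually_nhds_iff_ball.1 h1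
  rw [Real.ball_eq_Ioo] at h
  refine ⟨δ, hδ, fun θ hθ => (h θ hθ).1, strictMonoOn_of_deriv_pos (convex_Ioo _ _)
    M.g_smooth.continuous.continuousOn fun θ hθ => (h θ (interior_subset hθ)).2⟩

lemma law_eq_restrict (θ : ℝ) : M.law θ =
    (volume.restrict (Set.Ici (M.g θ))).withDensity fun y => ENNReal.ofReal (M.f y θ) := by
  rw [law, ← withDensity_indicator measurableSet_Ici]
  congr 1
  ext y
  by_cases h : M.g θ ≤ y <;> simp [dens, h]

lemma law_ac (θ : ℝ) : M.law θ ≪ volume.restrict (Set.Ici (M.g θ)) := by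
  rw [law_eq_restrict]
  exact withDensity_absolutelyContinuous _ _

lemma measurable_f {θ : ℝ} (hθ : θ ∈ M.N) : Measurable fun y => M.f y θ :=
  (M.f_cont θ hθ).measurable

lemma exists_score_sq_bound : ∃ δ > 0, Set.Ioo (M.θ0 - δ) (M.θ0 + δ) ⊆ M.N ∧
    StrictMonoOn M.g (Set.Ioo (M.θ0 - δ) (M.θ0 + δ)) ∧ ∃ a b, a < M.g M.θ0 ∧ M.g M.θ0 < b ∧
    ∃ G : ℝ → ℝ, (∀ y, 0 ≤ G y) ∧ Integrable G (M.law M.θ0) ∧ IntegrableOn G (Set.Icc a b) ∧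
      ∀ᵐ y, a ≤ y → ∀ θ ∈ M.N, M.score y θ ^ 2 ≤ G y := by
  obtain ⟨δ, hδ, hsub, hmono⟩ := M.exists_nhd
  obtain ⟨G, hGm, hG, hGint⟩ := M.exists_score_majorant
  have hmem0 : M.θ0 ∈ Set.Ioo (M.θ0 - δ) (M.θ0 + δ) := ⟨by linarith, by linarith⟩
  have hmem1 : M.θ0 - δ / 2 ∈ Set.Ioo (M.θ0 - δ) (M.θ0 + δ) := ⟨by linarith, by linarith⟩
  have hN1 := hsub hmem1
  refine ⟨δ, hδ, hsub, hmono, M.g (M.θ0 - δ / 2), M.g M.θ0 + 1,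
    hmono hmem1 hmem0 (by linarith), by linarith, fun y => (G y).toReal,
    fun y => ENNReal.toReal_nonneg, ?_, ?_, ?_⟩
  · refine integrable_toReal_of_lintegral_ne_top hGm.aemeasurable (ne_of_lt ?_)
    rw [law_eq_restrict, lintegral_withDensity_eq_lintegral_mul _
      (M.measurable_f M.θ0_mem).ennreal_ofReal hGm]
    simpa only [Pi.mul_apply, mul_comm] using hGint _ M.θ0_mem
  · refine integrable_toReal_of_lintegral_ne_top hGm.aemeasurable (ne_of_lt ?_)
    obtain ⟨c, hc, hcf⟩ := (isCompact_Icc (a := M.g (M.θ0 - δ / 2))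
      (b := M.g M.θ0 + 1)).exists_forall_le' (M.f_cont _ hN1).continuousOn
        (a := 0) fun y _ => M.f_pos _ hN1 y
    have hc' : ENNReal.ofReal c ≠ 0 := by simpa using hc
    calc ∫⁻ y in Set.Icc (M.g (M.θ0 - δ / 2)) (M.g M.θ0 + 1), G y
        ≤ ∫⁻ y in Set.Icc (M.g (M.θ0 - δ / 2)) (M.g M.θ0 + 1),
          (ENNReal.ofReal c)⁻¹ * (G y * ENNReal.ofReal (M.f y (M.θ0 - δ / 2))) := by
          refine setLIntegral_mono' measurableSet_Icc fun y hy => ?_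
          calc G y = (ENNReal.ofReal c)⁻¹ * (G y * ENNReal.ofReal c) := by
                rw [mul_comm (G y), ← mul_assoc, ENNReal.inv_mul_cancel hc' ENNReal.ofReal_ne_top,
                  one_mul]
            _ ≤ _ := by gcongr; exact hcf y hy
      _ ≤ ∫⁻ y in Set.Ici (M.g (M.θ0 - δ / 2)),
          (ENNReal.ofReal c)⁻¹ * (G y * ENNReal.ofReal (M.f y (M.θ0 - δ / 2))) :=
          lintegral_mono_set Set.Icc_subset_Ici_self
      _ = (ENNReal.ofReal c)⁻¹ * ∫⁻ y in Set.Ici (M.g (M.θ0 - δ / 2)),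
          G y * ENNReal.ofReal (M.f y (M.θ0 - δ / 2)) :=
          lintegral_const_mul _ (hGm.mul (M.measurable_f hN1).ennreal_ofReal)
      _ < ⊤ := ENNReal.mul_lt_top (by simpa using hc) (hGint _ hN1)
  · have := ae_lt_top (hGm.mul (M.measurable_f hN1).ennreal_ofReal) (hGint _ hN1).ne
    rw [ae_restrict_iff' measurableSet_Ici] at this
    filter_upwards [this] with y hy hay θ hθ
    have hfin : G y ≠ ⊤ := by
      intro h
      have h2 := hy hay
      rw [Pi.mul_apply, h, ENNReal.top_mul (by simpa using M.f_pos _ hN1 y)] at h2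
      exact lt_irrefl _ h2
    exact (ENNReal.ofReal_le_iff_le_toReal hfin).1 (hG θ hθ y)

lemma hasDerivAt_f (y θ : ℝ) : HasDerivAt (fun t => M.f y t) (deriv (fun t => M.f y t) θ) θ :=
  (M.differentiable_f y θ).hasDerivAt

lemma hasDerivAt_log_f (y : ℝ) {θ : ℝ} (hθ : θ ∈ M.N) :
    HasDerivAt (fun t => Real.log (M.f y t)) (M.score y θ) θ :=
  (M.hasDerivAt_f y θ).log (M.f_pos θ hθ y).ne'

lemma abs_log_f_sub_le {D : Set ℝ} (hD : D ⊆ M.N) (hconv : Convex ℝ D) {y K : ℝ}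
    (hK : ∀ θ ∈ M.N, M.score y θ ^ 2 ≤ K) {θ θ' : ℝ} (hθ : θ ∈ D) (hθ' : θ' ∈ D) :
    |Real.log (M.f y θ') - Real.log (M.f y θ)| ≤ √K * |θ' - θ| :=
  hconv.norm_image_sub_le_of_norm_hasDerivWithin_le
    (fun _ ht => (M.hasDerivAt_log_f y (hD ht)).hasDerivWithinAt)
    (fun t ht => Real.abs_le_sqrt (hK t (hD ht))) hθ hθ'

lemma abs_f_sub_le {D : Set ℝ} (hD : D ⊆ M.N) (hconv : Convex ℝ D) {y K : ℝ}
    (hK : ∀ θ ∈ M.N, M.score y θ ^ 2 ≤ K) {θ θ' : ℝ} (hθ : θ ∈ D) (hθ' : θ' ∈ D) :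
    |M.f y θ' - M.f y θ| ≤ M.C * √K * |θ' - θ| := by
  refine hconv.norm_image_sub_le_of_norm_hasDerivWithin_le
    (fun _ _ => (M.hasDerivAt_f y _).hasDerivWithinAt) (fun t ht => ?_) hθ hθ'
  have hpos := M.f_pos t (hD ht) y
  have : deriv (fun t => M.f y t) t = M.f y t * M.score y t := by
    rw [score]; field_simp
  rw [this, norm_mul, Real.norm_eq_abs, Real.norm_eq_abs, abs_of_pos hpos]
  exact mul_le_mul (M.f_lt t (hD ht) y).le (Real.abs_le_sqrt (hK t (hD ht))) (abs_nonneg _)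
    (hpos.le.trans (M.f_lt t (hD ht) y).le)

lemma sqrt_le_one_add {x : ℝ} (hx : 0 ≤ x) : √x ≤ 1 + x := by
  rw [Real.sqrt_le_left (by linarith)]
  nlinarith

lemma tendsto_local (θ h : ℝ) : Tendsto (fun n : ℕ => θ + h / n) atTop (𝓝 θ) := by
  simpa using (tendsto_const_div_atTop_nhds_zero_nat h).const_add θ

lemma tendsto_nat_mul_of_hasDerivAt {Φ : ℝ → ℝ} {x c : ℝ} (hΦ : HasDerivAt Φ c x) (h : ℝ) :
    Tendsto (fun n : ℕ => n * (Φ (x + h / n) - Φ x)) atTop (𝓝 (h * c)) := by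
  have h1 : HasDerivAt (fun t => Φ (x + h * t)) (c * h) 0 := by
    have h2 : HasDerivAt (fun t : ℝ => x + h * t) h 0 := by
      simpa using ((hasDerivAt_id (0 : ℝ)).const_mul h).const_add x
    exact HasDerivAt.comp 0 (by simpa using hΦ) h2
  have h3 := h1.tendsto_slope_zero_right.comp tendsto_inv_atTop_nhdsGT_zero
  have h4 := h3.comp (tendsto_natCast_atTop_atTop (R := ℝ))
  rw [mul_comm h c]
  refine h4.congr fun n => ?_
  simp [div_eq_mul_inv]

lemma tendsto_window_null (k : ℝ) :
    Tendsto (fun n : ℕ => n * ∫ y in M.g M.θ0..M.g (M.θ0 + k / n), M.f y M.θ0) atTop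
      (𝓝 (k * M.lam⁻¹)) := by
  have hc := M.f_cont _ M.θ0_mem
  have h1 : HasDerivAt (fun u => ∫ y in M.g M.θ0..u, M.f y M.θ0) (M.f (M.g M.θ0) M.θ0)
      (M.g M.θ0) :=
    intervalIntegral.integral_hasDerivAt_right (hc.intervalIntegrable _ _)
      (hc.stronglyMeasurableAtFilter _ _) hc.continuousAt
  have h2 : HasDerivAt M.g (deriv M.g M.θ0) M.θ0 :=
    (M.g_smooth.differentiable one_ne_zero _).hasDerivAt
  have h3 := tendsto_nat_mul_of_hasDerivAt (HasDerivAt.comp M.θ0 h1 h2) k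
  rw [lam, inv_inv]
  simpa using h3

lemma eventually_local {δ : ℝ} (hδ : 0 < δ) (h : ℝ) :
    ∀ᶠ n : ℕ in atTop, M.θ0 + h / n ∈ Set.Ioo (M.θ0 - δ) (M.θ0 + δ) :=
  (tendsto_local M.θ0 h).eventually (Ioo_mem_nhds (by linarith) (by linarith))

lemma eventually_mem_N (h : ℝ) : ∀ᶠ n : ℕ in atTop, M.θ0 + h / n ∈ M.N :=
  (tendsto_local M.θ0 h).eventually (M.N_open.mem_nhds M.θ0_mem)

lemma nat_mul_abs_local_le (θ h : ℝ) (n : ℕ) : (n : ℝ) * |θ + h / n - θ| ≤ |h| := by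
  rcases Nat.eq_zero_or_pos n with rfl | hn
  · simp
  · have : (0 : ℝ) < n := by exact_mod_cast hn
    rw [add_sub_cancel_left, abs_div, abs_of_pos this, mul_div_cancel₀ _ this.ne']

lemma tendsto_window_alt (h : ℝ) :
    Tendsto (fun n : ℕ => n * ∫ y in M.g (M.θ0 + h / n)..M.g M.θ0, M.f y (M.θ0 + h / n)) atTop
      (𝓝 (-h * M.lam⁻¹)) := by
  obtain ⟨δ, hδ, hsub, hmono, a, b, ha, hb, G, hG0, -, hGint, hG⟩ := M.exists_score_sq_bound
  have hab : a ≤ b := (ha.trans hb).le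
  have h1G : IntervalIntegrable (fun y => 1 + G y) volume a b := by
    refine (intervalIntegrable_const).add ?_
    rw [intervalIntegrable_iff_integrableOn_Icc_of_le hab]
    exact hGint
  have hprim : Tendsto (fun n : ℕ => ∫ y in M.g M.θ0..M.g (M.θ0 + h / n), (1 + G y)) atTop
      (𝓝 0) := by
    have hmem : M.g M.θ0 ∈ Set.uIcc a b := by
      rw [Set.uIcc_of_le hab]; exact ⟨ha.le, hb.le⟩
    have hc := (intervalIntegral.continuousOn_primitive_interval' h1G hmem).continuousAt
      (by rw [Set.uIcc_of_le hab]; exact Icc_mem_nhds ha hb)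
    have h2 := hc.tendsto.comp
      ((M.g_smooth.continuous.tendsto M.θ0).comp (tendsto_local M.θ0 h))
    simpa [Function.comp_def] using h2
  have hdiff : Tendsto (fun n : ℕ => n * ∫ y in M.g M.θ0..M.g (M.θ0 + h / n),
      (M.f y (M.θ0 + h / n) - M.f y M.θ0)) atTop (𝓝 0) := by
    have hlim : Tendsto (fun n : ℕ => |h| * M.C *
        |∫ y in M.g M.θ0..M.g (M.θ0 + h / n), (1 + G y)|) atTop (𝓝 0) := by
      simpa using (hprim.abs).const_mul (|h| * M.C)
    refine squeeze_zero_norm' ?_ hlim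
    have hgev : ∀ᶠ n : ℕ in atTop, M.g (M.θ0 + h / n) ∈ Set.Ioo a b :=
      ((M.g_smooth.continuous.tendsto M.θ0).comp (tendsto_local M.θ0 h)).eventually
        (Ioo_mem_nhds ha hb)
    filter_upwards [M.eventually_local hδ h, hgev] with n hn hgn
    have hC : 0 ≤ M.C := ((M.f_pos _ M.θ0_mem 0).trans (M.f_lt _ M.θ0_mem 0)).le
    have hbd : ‖∫ y in M.g M.θ0..M.g (M.θ0 + h / n), (M.f y (M.θ0 + h / n) - M.f y M.θ0)‖ ≤
        |∫ y in M.g M.θ0..M.g (M.θ0 + h / n),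
          (M.C * |M.θ0 + h / n - M.θ0|) * (1 + G y)| := by
      refine intervalIntegral.norm_integral_le_abs_of_norm_le ?_ ?_
      · rw [ae_restrict_iff' measurableSet_uIoc]
        filter_upwards [hG] with y hy hyI
        have hay : a ≤ y := by
          rcases Set.mem_uIoc.1 hyI with h | h
          · linarith [h.1]
          · linarith [h.1, hgn.1]
        refine (M.abs_f_sub_le hsub (convex_Ioo _ _) (hy hay)
          ⟨by linarith, by linarith⟩ hn).trans ?_
        calc M.C * √(G y) * |M.θ0 + h / n - M.θ0|
            = M.C * |M.θ0 + h / n - M.θ0| * √(G y) := by ring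
          _ ≤ _ := by gcongr; exact sqrt_le_one_add (hG0 y)
      · refine (h1G.mono_set ?_).const_mul _
        rw [Set.uIcc_of_le hab]
        exact Set.uIcc_subset_Icc ⟨ha.le, hb.le⟩ ⟨hgn.1.le, hgn.2.le⟩
    rw [intervalIntegral.integral_const_mul, abs_mul, abs_mul, abs_abs, abs_of_nonneg hC] at hbd
    rw [norm_mul, Real.norm_natCast]
    calc (n : ℝ) * _ ≤ n * _ := mul_le_mul_of_nonneg_left hbd n.cast_nonneg
      _ = ((n : ℝ) * |M.θ0 + h / n - M.θ0|) *
          (M.C * |∫ y in M.g M.θ0..M.g (M.θ0 + h / n), (1 + G y)|) := by ring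
      _ ≤ |h| * (M.C * |∫ y in M.g M.θ0..M.g (M.θ0 + h / n), (1 + G y)|) :=
        mul_le_mul_of_nonneg_right (nat_mul_abs_local_le _ _ _) (by positivity)
      _ = _ := by ring
  have hsum := (hdiff.add (M.tendsto_window_null h)).neg
  rw [zero_add, ← neg_mul] at hsum
  refine hsum.congr' ?_
  filter_upwards [M.eventually_mem_N h] with n hn
  rw [intervalIntegral.integral_sub ((M.f_cont _ hn).intervalIntegrable _ _)
    ((M.f_cont _ M.θ0_mem).intervalIntegrable _ _), intervalIntegral.integral_symm]
  ring

lemma setIntegral_Ici_f {θ c : ℝ} (hc : M.g θ ≤ c) :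
    ∫ y in Set.Ici c, M.f y θ = 1 - ∫ y in M.g θ..c, M.f y θ := by
  have h1 := M.f_density θ
  have h2 := M.f_integrable θ
  rw [integral_Ici_eq_integral_Ioi] at h1 ⊢
  rw [integrableOn_Ici_iff_integrableOn_Ioi] at h2
  rw [← intervalIntegral.integral_Ioi_sub_Ioi h2 hc, h1]
  ring

/-- Differentiating the normalisation `∫ f(y|θ)·𝟙{y ≥ g θ} dy = 1` at `θ0`. -/
lemma integral_deriv_f :
    ∫ y in Set.Ici (M.g M.θ0), deriv (fun t => M.f y t) M.θ0 = M.lam⁻¹ := by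
  obtain ⟨δ, hδ, hsub, hmono⟩ := M.exists_nhd
  obtain ⟨T, hTm, hT, hTint⟩ := M.exists_deriv_majorant hsub hmono hδ
  have hev : ∀ᶠ n : ℕ in atTop, M.θ0 + (-1) / n ∈ Set.Ioo (M.θ0 - δ) M.θ0 := by
    filter_upwards [M.eventually_local hδ (-1), eventually_gt_atTop 0] with n hn hn0
    have : (0 : ℝ) < n := by exact_mod_cast hn0
    exact ⟨hn.1, by linarith [div_neg_of_neg_of_pos (show (-1 : ℝ) < 0 by norm_num) this]⟩
  have hlim : Tendsto (fun n : ℕ => ∫ y in Set.Ici (M.g M.θ0),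
      n * (M.f y (M.θ0 + (-1) / n) - M.f y M.θ0)) atTop
      (𝓝 (∫ y in Set.Ici (M.g M.θ0), -1 * deriv (fun t => M.f y t) M.θ0)) := by
    refine tendsto_integral_filter_of_dominated_convergence (fun y => (T y).toReal) ?_ ?_
      (integrable_toReal_of_lintegral_ne_top hTm.aemeasurable hTint.ne)
      (Eventually.of_forall fun y => tendsto_nat_mul_of_hasDerivAt (M.hasDerivAt_f y M.θ0) (-1))
    · filter_upwards [M.eventually_mem_N (-1)] with n hn
      exact (((M.measurable_f hn).sub (M.measurable_f M.θ0_mem)).const_mul _).aestronglyMeasurable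
    · filter_upwards [hev] with n hn
      filter_upwards [ae_lt_top hTm hTint.ne] with y hy
      obtain ⟨ξ, hξ, hslope⟩ := exists_deriv_eq_slope (fun t => M.f y t) hn.2
        (M.differentiable_f y).continuous.continuousOn (M.differentiable_f y).differentiableOn
      have hξT := (ENNReal.ofReal_le_iff_le_toReal hy.ne).1 (hT ξ ⟨hn.1.trans hξ.1, hξ.2⟩ y)
      have hpos : 0 < M.θ0 - (M.θ0 + (-1) / n) := by linarith [hn.2]
      rw [eq_div_iff hpos.ne'] at hslope
      rw [norm_mul, Real.norm_natCast, Real.norm_eq_abs, abs_sub_comm, ← hslope, abs_mul,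
        abs_sub_comm M.θ0]
      calc (n : ℝ) * (|deriv (fun t => M.f y t) ξ| * |M.θ0 + (-1) / n - M.θ0|)
          = |deriv (fun t => M.f y t) ξ| * (n * |M.θ0 + (-1) / n - M.θ0|) := by ring
        _ ≤ |deriv (fun t => M.f y t) ξ| * |-1| :=
          mul_le_mul_of_nonneg_left (nat_mul_abs_local_le _ _ _) (abs_nonneg _)
        _ ≤ _ := by simpa using hξT
  have hlim' := (M.tendsto_window_alt (-1)).neg
  have heq := tendsto_nhds_unique hlim (hlim'.congr' ?_)
  · rw [integral_const_mul] at heq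
    linarith
  filter_upwards [hev] with n hn
  have hle : M.g (M.θ0 + (-1) / n) ≤ M.g M.θ0 :=
    (hmono ⟨hn.1, by linarith [hn.2]⟩ ⟨by linarith, by linarith⟩ hn.2).le
  rw [integral_const_mul, integral_sub ((M.f_integrable _).mono_set (Set.Ici_subset_Ici.2 hle))
    (M.f_integrable _), M.f_density, M.setIntegral_Ici_f hle]
  ring

/-- The log-likelihood ratio of a single observation. -/
def logRatio (n : ℕ) (h y : ℝ) : ℝ :=
  Real.log (M.f y (M.θ0 + h / n)) - Real.log (M.f y M.θ0)

lemma measurable_logRatio {n : ℕ} {h : ℝ} (hn : M.θ0 + h / n ∈ M.N) :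
    Measurable (M.logRatio n h) :=
  (M.measurable_f hn).log.sub (M.measurable_f M.θ0_mem).log

lemma ae_law_ge (θ : ℝ) : ∀ᵐ y ∂M.law θ, M.g θ ≤ y :=
  (M.law_ac θ).ae_le (ae_restrict_mem measurableSet_Ici)

lemma exists_logRatio_bound (h : ℝ) : ∃ G : ℝ → ℝ, (∀ y, 0 ≤ G y) ∧
    Integrable G (M.law M.θ0) ∧ ∀ᶠ n : ℕ in atTop,
      ∀ᵐ y ∂M.law M.θ0, n * |M.logRatio n h y| ≤ |h| * √(G y) := by
  obtain ⟨δ, hδ, hsub, -, a, b, ha, -, G, hG0, hGint, -, hG⟩ := M.exists_score_sq_bound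
  refine ⟨G, hG0, hGint, ?_⟩
  filter_upwards [M.eventually_local hδ h] with n hn
  have hac : M.law M.θ0 ≪ volume := withDensity_absolutelyContinuous _ _
  filter_upwards [M.ae_law_ge M.θ0, hac.ae_le hG] with y hy hyG
  have h1 := M.abs_log_f_sub_le (θ := M.θ0) hsub (convex_Ioo _ _) (hyG (ha.le.trans hy))
    ⟨by linarith, by linarith⟩ hn
  calc (n : ℝ) * |M.logRatio n h y| ≤ n * (√(G y) * |M.θ0 + h / n - M.θ0|) :=
        mul_le_mul_of_nonneg_left h1 n.cast_nonneg
    _ = √(G y) * (n * |M.θ0 + h / n - M.θ0|) := by ring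
    _ ≤ √(G y) * |h| :=
        mul_le_mul_of_nonneg_left (nat_mul_abs_local_le _ _ _) (Real.sqrt_nonneg _)
    _ = _ := mul_comm _ _

lemma tendsto_mean_logRatio (h : ℝ) :
    Tendsto (fun n : ℕ => n * ∫ y, M.logRatio n h y ∂M.law M.θ0) atTop (𝓝 (h * M.lam⁻¹)) := by
  obtain ⟨G, hG0, hGint, hG⟩ := M.exists_logRatio_bound h
  have hscore : ∫ y, M.score y M.θ0 ∂M.law M.θ0 = M.lam⁻¹ := by
    rw [law_eq_restrict, integral_withDensity_eq_integral_toReal_smul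
      (M.measurable_f M.θ0_mem).ennreal_ofReal (by simp), ← integral_deriv_f]
    refine integral_congr_ae (Eventually.of_forall fun y => ?_)
    have := M.f_pos _ M.θ0_mem y
    simp only [smul_eq_mul, ENNReal.toReal_ofReal this.le, score]
    field_simp
  rw [← hscore, ← integral_const_mul]
  simp_rw [← integral_const_mul]
  refine tendsto_integral_filter_of_dominated_convergence (fun y => |h| * (1 + G y)) ?_ ?_
    (((integrable_const _).add hGint).const_mul _)
    (Eventually.of_forall fun y => tendsto_nat_mul_of_hasDerivAt
      (M.hasDerivAt_log_f y M.θ0_mem) h)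
  · filter_upwards [M.eventually_mem_N h] with n hn
    exact ((M.measurable_logRatio hn).const_mul _).aestronglyMeasurable
  · filter_upwards [hG] with n hn
    filter_upwards [hn] with y hy
    rw [norm_mul, Real.norm_natCast, Real.norm_eq_abs]
    exact hy.trans (mul_le_mul_of_nonneg_left (sqrt_le_one_add (hG0 y)) (abs_nonneg _))

lemma sq_moment_logRatio (h : ℝ) : ∃ K : ℝ, ∀ᶠ n : ℕ in atTop,
    MemLp (M.logRatio n h) 2 (M.law M.θ0) ∧
      n ^ 2 * ∫ y, M.logRatio n h y ^ 2 ∂M.law M.θ0 ≤ K := by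
  obtain ⟨G, hG0, hGint, hG⟩ := M.exists_logRatio_bound h
  refine ⟨∫ y, h ^ 2 * G y ∂M.law M.θ0, ?_⟩
  filter_upwards [hG, M.eventually_mem_N h, eventually_gt_atTop 0] with n hn hN hn0
  have hpos : (0 : ℝ) < n := by exact_mod_cast hn0
  have hbd : ∀ᵐ y ∂M.law M.θ0, n ^ 2 * M.logRatio n h y ^ 2 ≤ h ^ 2 * G y := by
    filter_upwards [hn] with y hy
    have h1 := pow_le_pow_left₀ (by positivity) hy 2
    rwa [mul_pow, mul_pow, sq_abs, sq_abs, Real.sq_sqrt (hG0 y)] at h1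
  have hsq : Integrable (fun y => n ^ 2 * M.logRatio n h y ^ 2) (M.law M.θ0) := by
    refine (hGint.const_mul (h ^ 2)).mono'
      (((M.measurable_logRatio hN).pow_const 2).const_mul _).aestronglyMeasurable ?_
    filter_upwards [hbd] with y hy
    rwa [Real.norm_of_nonneg (by positivity)]
  constructor
  · rw [memLp_two_iff_integrable_sq (M.measurable_logRatio hN).aestronglyMeasurable]
    refine (hsq.const_mul ((n ^ 2 : ℝ)⁻¹)).congr (Eventually.of_forall fun y => ?_)
    field_simp
  · rw [← integral_const_mul]
    exact integral_mono_ae hsq (hGint.const_mul _) hbd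

lemma abs_integral_le_sqrt {Ω : Type*} [MeasurableSpace Ω] {μ : Measure Ω}
    [IsProbabilityMeasure μ] {X : Ω → ℝ} (hX : MemLp X 2 μ) :
    ∫ ω, |X ω| ∂μ ≤ √(∫ ω, X ω ^ 2 ∂μ) := by
  refine Real.le_sqrt_of_sq_le ?_
  have h1 := ProbabilityTheory.variance_nonneg |X| μ
  rw [ProbabilityTheory.variance_eq_sub hX.abs] at h1
  simpa using h1

/-- Law of large numbers for the log-likelihood ratio, in `L¹`. -/
lemma tendsto_sum_logRatio (h : ℝ) :
    Tendsto (fun n : ℕ => ∫ y, |∑ i, M.logRatio n h (y i) - h * M.lam⁻¹| ∂M.P n M.θ0) atTop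
      (𝓝 0) ∧ ∀ᶠ n : ℕ in atTop,
        Integrable (fun y => ∑ i, M.logRatio n h (y i) - h * M.lam⁻¹) (M.P n M.θ0) := by
  obtain ⟨K, hK⟩ := M.sq_moment_logRatio h
  have hmem : ∀ n : ℕ, MemLp (M.logRatio n h) 2 (M.law M.θ0) →
      MemLp (fun y : Fin n → ℝ => ∑ i, M.logRatio n h (y i)) 2 (M.P n M.θ0) := by
    intro n hn
    rw [P_eq_pi]
    exact memLp_finsetSum _ fun i _ => hn.comp_measurePreserving (measurePreserving_eval _ i)
  have hK0 : Tendsto (fun n : ℕ => √(K / n) +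
      |n * ∫ y, M.logRatio n h y ∂M.law M.θ0 - h * M.lam⁻¹|) atTop (𝓝 0) := by
    have h1 := (tendsto_const_div_atTop_nhds_zero_nat K).sqrt
    have h2 := ((M.tendsto_mean_logRatio h).sub_const (h * M.lam⁻¹)).abs
    simpa using h1.add h2
  constructor
  · refine squeeze_zero' (Eventually.of_forall fun n => integral_nonneg fun y => abs_nonneg _)
      ?_ hK0
    filter_upwards [hK, eventually_gt_atTop 0] with n hn hn0
    obtain ⟨hL, hKn⟩ := hn
    have hpos : (0 : ℝ) < n := by exact_mod_cast hn0
    set S : (Fin n → ℝ) → ℝ := fun y => ∑ i, M.logRatio n h (y i) with hS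
    set m := ∫ y, M.logRatio n h y ∂M.law M.θ0 with hm
    have hSL := hmem n hL
    have hmean : ∫ y, S y ∂M.P n M.θ0 = n * m := by
      rw [hS, P_eq_pi, integral_finsetSum]
      · simp_rw [integral_comp_eval (μ := fun _ : Fin n => M.law M.θ0) hL.1]
        simp [hm]
      · intro i _
        exact (hL.comp_measurePreserving (measurePreserving_eval _ i)).integrable (by norm_num)
    have hvar : ∫ y, (S y - n * m) ^ 2 ∂M.P n M.θ0 ≤ K / n := by
      have h1 := ProbabilityTheory.variance_eq_integral hSL.1.aemeasurable
      rw [hmean] at h1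
      have h2 : ProbabilityTheory.variance S (M.P n M.θ0) =
          n * ProbabilityTheory.variance (M.logRatio n h) (M.law M.θ0) := by
        have h3 := ProbabilityTheory.variance_sum_pi (ι := Fin n)
          (μ := fun _ => M.law M.θ0) (X := fun _ => M.logRatio n h) fun _ => hL
        rw [← P_eq_pi] at h3
        have : S = ∑ i, fun ω : Fin n → ℝ => M.logRatio n h (ω i) := by
          ext y; simp [hS]
        rw [this, h3]; simp
      have h4 : ProbabilityTheory.variance (M.logRatio n h) (M.law M.θ0) ≤
          ∫ y, M.logRatio n h y ^ 2 ∂M.law M.θ0 :=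
        ProbabilityTheory.variance_le_expectation_sq hL.1
      rw [← h1, h2, le_div_iff₀ hpos]
      refine le_trans ?_ hKn
      calc _ = (n : ℝ) ^ 2 * ProbabilityTheory.variance (M.logRatio n h) (M.law M.θ0) := by ring
        _ ≤ _ := by gcongr
    have hcL : MemLp (fun y => S y - n * m) 2 (M.P n M.θ0) := hSL.sub (memLp_const _)
    calc ∫ y, |S y - h * M.lam⁻¹| ∂M.P n M.θ0
        ≤ ∫ y, (|S y - n * m| + |n * m - h * M.lam⁻¹|) ∂M.P n M.θ0 := by
          refine integral_mono ((hSL.sub (memLp_const _)).integrable (by norm_num)).abs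
            ((hcL.integrable (by norm_num)).abs.add (integrable_const _)) fun y => ?_
          exact abs_sub_le _ _ _
      _ = ∫ y, |S y - n * m| ∂M.P n M.θ0 + |n * m - h * M.lam⁻¹| := by
          rw [integral_add (hcL.integrable (by norm_num)).abs (integrable_const _)]
          simp
      _ ≤ _ := by
          gcongr
          exact (abs_integral_le_sqrt hcL).trans (Real.sqrt_le_sqrt hvar)
  · filter_upwards [hK] with n hn
    exact ((hmem n hn.1).integrable (by norm_num)).sub (integrable_const _)

/-- The event that every observation lies above the boundary `g(θ0 + k/n)`. -/
def above (n : ℕ) (k : ℝ) : Set (Fin n → ℝ) := {y | ∀ i, M.g (M.θ0 + k / n) ≤ y i}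

lemma above_eq_pi (n : ℕ) (k : ℝ) :
    M.above n k = Set.univ.pi fun _ => Set.Ici (M.g (M.θ0 + k / n)) := by
  ext y; simp [above, Pi.le_def]

lemma measurableSet_above (n : ℕ) (k : ℝ) : MeasurableSet (M.above n k) := by
  rw [above_eq_pi]
  exact MeasurableSet.univ_pi fun _ => measurableSet_Ici

lemma law_real_Ici {θ c : ℝ} (hc : M.g θ ≤ c) :
    (M.law θ).real (Set.Ici c) = 1 - ∫ y in M.g θ..c, M.f y θ := by
  have hsub : Set.Ici c ⊆ Set.Ici (M.g θ) := Set.Ici_subset_Ici.2 hc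
  rw [← M.setIntegral_Ici_f hc, measureReal_def, law_eq_restrict,
    withDensity_apply _ measurableSet_Ici, Measure.restrict_restrict measurableSet_Ici,
    Set.inter_eq_left.2 hsub, ← ofReal_integral_eq_lintegral_ofReal
      ((M.f_integrable θ).mono_set hsub), ENNReal.toReal_ofReal]
  · exact setIntegral_nonneg measurableSet_Ici fun y hy => M.f_nonneg θ y (hc.trans hy)
  · filter_upwards [ae_restrict_mem measurableSet_Ici] with y hy
    exact M.f_nonneg θ y (hc.trans hy)

lemma law_real_Ici_of_le {θ c : ℝ} (hc : c ≤ M.g θ) : (M.law θ).real (Set.Ici c) = 1 := by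
  rw [measureReal_def, (mem_ae_iff_prob_eq_one measurableSet_Ici).1, ENNReal.toReal_one]
  filter_upwards [M.ae_law_ge θ] with y hy
  exact hc.trans hy

lemma P_real_above (n : ℕ) (θ k : ℝ) :
    (M.P n θ).real (M.above n k) = (M.law θ).real (Set.Ici (M.g (M.θ0 + k / n))) ^ n := by
  rw [P_eq_pi, above_eq_pi, measureReal_def, Measure.pi_pi]
  simp [measureReal_def]

lemma P_real_above_zero_null (n : ℕ) : (M.P n M.θ0).real (M.above n 0) = 1 := by
  rw [P_real_above, law_real_Ici_of_le, one_pow]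
  simp

lemma ae_mem_above_zero (n : ℕ) : ∀ᵐ y ∂M.P n M.θ0, y ∈ M.above n 0 := by
  have h := M.P_real_above_zero_null n
  rw [measureReal_def, ENNReal.toReal_eq_one_iff] at h
  exact (mem_ae_iff_prob_eq_one (M.measurableSet_above n 0)).2 h

lemma eventually_g_le {h k : ℝ} (hhk : h ≤ k) :
    ∀ᶠ n : ℕ in atTop, M.g (M.θ0 + h / n) ≤ M.g (M.θ0 + k / n) := by
  obtain ⟨δ, hδ, -, hmono⟩ := M.exists_nhd
  filter_upwards [M.eventually_local hδ h, M.eventually_local hδ k] with n h1 h2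
  exact hmono.monotoneOn h1 h2 (by gcongr)

lemma tendsto_null_above (k : ℝ) :
    Tendsto (fun n : ℕ => (M.P n M.θ0).real (M.above n k)) atTop
      (𝓝 (exp (-(max k 0) * M.lam⁻¹))) := by
  simp_rw [P_real_above]
  rcases le_total 0 k with hk | hk
  · rw [max_eq_left hk]
    have h1 := (M.tendsto_window_null k).neg
    simp_rw [← mul_neg] at h1
    rw [mul_neg, ← neg_mul] at h1
    refine (Real.tendsto_one_add_pow_exp_of_tendsto h1).congr' ?_
    filter_upwards [M.eventually_g_le hk] with n hn
    rw [zero_div, add_zero] at hn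
    rw [law_real_Ici _ hn, sub_eq_add_neg]
  · rw [max_eq_right hk, neg_zero, zero_mul, Real.exp_zero]
    refine tendsto_const_nhds.congr' ?_
    filter_upwards [M.eventually_g_le hk] with n hn
    rw [zero_div, add_zero] at hn
    rw [law_real_Ici_of_le _ hn, one_pow]

lemma tendsto_alt_above (h : ℝ) :
    Tendsto (fun n : ℕ => (M.P n (M.θ0 + h / n)).real (M.above n 0)) atTop
      (𝓝 (exp (-(max (-h) 0) * M.lam⁻¹))) := by
  simp_rw [P_real_above]
  rcases le_total h 0 with hh | hh
  · rw [max_eq_left (by linarith), neg_neg]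
    have h1 := (M.tendsto_window_alt h).neg
    simp_rw [← mul_neg] at h1
    rw [mul_neg, neg_mul, neg_neg] at h1
    refine (Real.tendsto_one_add_pow_exp_of_tendsto h1).congr' ?_
    filter_upwards [M.eventually_g_le hh] with n hn
    rw [law_real_Ici _ hn, sub_eq_add_neg, zero_div, add_zero]
  · rw [max_eq_right (by linarith), neg_zero, zero_mul, Real.exp_zero]
    refine tendsto_const_nhds.congr' ?_
    filter_upwards [M.eventually_g_le hh] with n hn
    rw [law_real_Ici_of_le _ hn, one_pow]

lemma Z_of_mem {n : ℕ} {h : ℝ} {y : Fin n → ℝ} (h0 : y ∈ M.above n 0) (hh : y ∈ M.above n h) :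
    M.Z n 0 h y = ∏ i, M.f (y i) (M.θ0 + h / n) / M.f (y i) M.θ0 := by
  rw [above, Set.mem_ofPred_eq] at h0 hh
  rw [Z, if_pos h0, if_pos hh, one_mul]
  simp

lemma Z_of_notMem {n : ℕ} {h : ℝ} {y : Fin n → ℝ} (hy : y ∉ M.above n h) :
    M.Z n 0 h y = 0 := by
  rw [above, Set.mem_ofPred_eq] at hy
  rw [Z, if_neg hy, zero_mul, ite_self]

lemma Z_of_notMem_zero {n : ℕ} {h : ℝ} {y : Fin n → ℝ} (hy : y ∉ M.above n 0) :
    M.Z n 0 h y = 0 := by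
  rw [above, Set.mem_ofPred_eq] at hy
  rw [Z, if_neg hy]

lemma Z_nonneg {n : ℕ} {h : ℝ} (hn : M.θ0 + h / n ∈ M.N) (y : Fin n → ℝ) :
    0 ≤ M.Z n 0 h y := by
  by_cases h0 : y ∈ M.above n 0
  · by_cases hh : y ∈ M.above n h
    · rw [Z_of_mem M h0 hh]
      exact Finset.prod_nonneg fun i _ =>
        div_nonneg (M.f_pos _ hn _).le (M.f_pos _ M.θ0_mem _).le
    · rw [Z_of_notMem M hh]
  · rw [Z_of_notMem_zero M h0]

lemma measurable_Z {n : ℕ} {h : ℝ} (hn : M.θ0 + h / n ∈ M.N) : Measurable (M.Z n 0 h) := by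
  have heq : M.Z n 0 h = (M.above n 0 ∩ M.above n h).indicator
      fun y => ∏ i, M.f (y i) (M.θ0 + h / n) / M.f (y i) M.θ0 := by
    ext y
    by_cases h0 : y ∈ M.above n 0
    · by_cases hh : y ∈ M.above n h
      · rw [Z_of_mem M h0 hh, Set.indicator_of_mem (Set.mem_inter h0 hh)]
      · rw [Z_of_notMem M hh, Set.indicator_of_notMem fun h => hh h.2]
    · rw [Z_of_notMem_zero M h0, Set.indicator_of_notMem fun h => h0 h.1]
  rw [heq]
  refine Measurable.indicator (Finset.measurable_prod _ fun i _ => ?_)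
    ((M.measurableSet_above n 0).inter (M.measurableSet_above n h))
  exact ((M.measurable_f hn).comp (measurable_pi_apply i)).div
    ((M.measurable_f M.θ0_mem).comp (measurable_pi_apply i))

lemma measurable_prod_dens {n : ℕ} {θ : ℝ} (hθ : θ ∈ M.N) :
    Measurable fun y : Fin n → ℝ => ∏ i, M.dens θ (y i) := by
  refine Finset.measurable_prod _ fun i _ => ?_
  rw [dens_eq_indicator]
  exact ((M.measurable_f hθ).indicator measurableSet_Ici).comp (measurable_pi_apply i)

/-- `Z_n(0,h)` is the density of `P_{θ0+h/n}^n` with respect to `P_{θ0}^n` on the support of the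
latter. -/
lemma withDensity_Z {n : ℕ} {h : ℝ} (hn : M.θ0 + h / n ∈ M.N) :
    (M.P n M.θ0).withDensity (fun y => ENNReal.ofReal (M.Z n 0 h y)) =
      (M.P n (M.θ0 + h / n)).restrict (M.above n 0) := by
  have hP : ∀ θ, M.P n θ = (volume : Measure (Fin n → ℝ)).withDensity
      fun y => ENNReal.ofReal (∏ i, M.dens θ (y i)) := fun θ => rfl
  rw [hP, hP, restrict_withDensity (M.measurableSet_above n 0),
    ← withDensity_indicator (M.measurableSet_above n 0),
    ← withDensity_mul _ (M.measurable_prod_dens M.θ0_mem).ennreal_ofReal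
      (M.measurable_Z hn).ennreal_ofReal]
  congr 1
  ext y
  rw [Pi.mul_apply, ← ENNReal.ofReal_mul (Finset.prod_nonneg fun i _ => M.dens_nonneg _ _)]
  by_cases h0 : y ∈ M.above n 0
  · rw [Set.indicator_of_mem h0]
    congr 1
    by_cases hh : y ∈ M.above n h
    · rw [Z_of_mem M h0 hh, ← Finset.prod_mul_distrib]
      refine Finset.prod_congr rfl fun i _ => ?_
      have h1 := h0 i
      rw [zero_div, add_zero] at h1
      have h2 := (M.f_pos _ M.θ0_mem (y i)).ne'
      rw [dens, dens, if_pos h1, if_pos (hh i)]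
      field_simp
    · rw [Z_of_notMem M hh, mul_zero]
      simp only [above, Set.mem_ofPred_eq, not_forall] at hh
      obtain ⟨i, hi⟩ := hh
      rw [Finset.prod_eq_zero (Finset.mem_univ i)]
      rw [dens, if_neg hi, mul_zero]
  · rw [Set.indicator_of_notMem h0, Z_of_notMem_zero M h0, mul_zero, ENNReal.ofReal_zero]

lemma setIntegral_above {n : ℕ} {h : ℝ} (hn : M.θ0 + h / n ∈ M.N) (ψ : (Fin n → ℝ) → ℝ) :
    ∫ y in M.above n 0, ψ y ∂M.P n (M.θ0 + h / n) = ∫ y, M.Z n 0 h y * ψ y ∂M.P n M.θ0 := by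
  rw [← withDensity_Z M hn, integral_withDensity_eq_integral_toReal_smul
    (M.measurable_Z hn).ennreal_ofReal (by simp)]
  refine integral_congr_ae (Eventually.of_forall fun y => ?_)
  simp only [smul_eq_mul, ENNReal.toReal_ofReal (M.Z_nonneg hn y)]

lemma integrable_Z {n : ℕ} {h : ℝ} (hn : M.θ0 + h / n ∈ M.N) :
    Integrable (M.Z n 0 h) (M.P n M.θ0) := by
  refine ⟨(M.measurable_Z hn).aestronglyMeasurable, ?_⟩
  rw [hasFiniteIntegral_iff_ofReal (Eventually.of_forall (M.Z_nonneg hn)),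
    ← setLIntegral_univ, ← withDensity_apply _ MeasurableSet.univ, withDensity_Z M hn]
  exact measure_lt_top _ _

lemma integral_Z {n : ℕ} {h : ℝ} (hn : M.θ0 + h / n ∈ M.N) :
    ∫ y, M.Z n 0 h y ∂M.P n M.θ0 = (M.P n (M.θ0 + h / n)).real (M.above n 0) := by
  have := M.setIntegral_above hn fun _ => 1
  simpa using this.symm

/-- The limiting likelihood ratio `e^{h/λ}·𝟙{min_i y_i ≥ g(θ0 + h/n)}`. -/
def limitZ (n : ℕ) (h : ℝ) : (Fin n → ℝ) → ℝ :=
  (M.above n h).indicator fun _ => exp (h * M.lam⁻¹)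

lemma integrable_limitZ (n : ℕ) (h : ℝ) : Integrable (M.limitZ n h) (M.P n M.θ0) :=
  (integrable_const _).indicator (M.measurableSet_above n h)

lemma integral_limitZ (n : ℕ) (h : ℝ) :
    ∫ y, M.limitZ n h y ∂M.P n M.θ0 =
      exp (h * M.lam⁻¹) * (M.P n M.θ0).real (M.above n h) := by
  rw [limitZ, integral_indicator (M.measurableSet_above n h)]
  simp [mul_comm]

lemma limitZ_nonneg (n : ℕ) (h : ℝ) (y : Fin n → ℝ) : 0 ≤ M.limitZ n h y :=
  Set.indicator_nonneg (fun _ _ => (exp_pos _).le) y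

lemma limitZ_le (n : ℕ) (h : ℝ) (y : Fin n → ℝ) : M.limitZ n h y ≤ exp (h * M.lam⁻¹) :=
  Set.indicator_le_self' (fun _ _ => (exp_pos _).le) y

lemma exp_sub_exp_le (c x : ℝ) : exp c - exp x ≤ exp c * |x - c| := by
  have h1 := Real.add_one_le_exp (x - c)
  have h2 : exp x = exp c * exp (x - c) := by rw [← Real.exp_add]; ring_nf
  rw [h2]
  nlinarith [exp_pos c, neg_abs_le (x - c)]

/-- The likelihood ratio is asymptotically equal to its limiting form, in `L¹`. -/
lemma tendsto_Z_sub_limitZ (h : ℝ) :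
    Tendsto (fun n : ℕ => ∫ y, |M.Z n 0 h y - M.limitZ n h y| ∂M.P n M.θ0) atTop (𝓝 0) := by
  obtain ⟨hS, hSint⟩ := M.tendsto_sum_logRatio h
  have hlim : Tendsto (fun n : ℕ => (M.P n (M.θ0 + h / n)).real (M.above n 0) -
      exp (h * M.lam⁻¹) * (M.P n M.θ0).real (M.above n h) + 2 * exp (h * M.lam⁻¹) *
        ∫ y, |∑ i, M.logRatio n h (y i) - h * M.lam⁻¹| ∂M.P n M.θ0) atTop (𝓝 0) := by
    have h1 := ((M.tendsto_alt_above h).sub ((M.tendsto_null_above h).const_mul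
      (exp (h * M.lam⁻¹)))).add (hS.const_mul (2 * exp (h * M.lam⁻¹)))
    have h2 : -max (-h) 0 = h + -max h 0 := by
      rcases le_total h 0 with hh | hh
      · rw [max_eq_left (by linarith), max_eq_right hh]; ring
      · rw [max_eq_right (by linarith), max_eq_left hh]; ring
    rw [← Real.exp_add, ← add_mul, h2, sub_self, mul_zero, add_zero] at h1
    exact h1
  refine squeeze_zero' (Eventually.of_forall fun n => integral_nonneg fun y => abs_nonneg _) ?_ hlim
  filter_upwards [hSint, M.eventually_mem_N h] with n hSn hn
  have hI : Integrable (fun y => M.Z n 0 h y - M.limitZ n h y) (M.P n M.θ0) :=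
    (M.integrable_Z hn).sub (M.integrable_limitZ n h)
  rw [← integral_Z M hn, ← integral_limitZ,
    ← integral_sub (M.integrable_Z hn) (M.integrable_limitZ n h), ← integral_const_mul,
    ← integral_add hI (hSn.abs.const_mul _)]
  refine integral_mono_ae hI.abs (hI.add (hSn.abs.const_mul _)) ?_
  filter_upwards [M.ae_mem_above_zero n] with y h0
  by_cases hh : y ∈ M.above n h
  · have hZ : M.Z n 0 h y = exp (∑ i, M.logRatio n h (y i)) := by
      rw [Z_of_mem M h0 hh, Real.exp_sum]
      refine Finset.prod_congr rfl fun i _ => ?_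
      rw [logRatio, Real.exp_sub, Real.exp_log (M.f_pos _ hn _),
        Real.exp_log (M.f_pos _ M.θ0_mem _)]
    have h1 := exp_sub_exp_le (h * M.lam⁻¹) (∑ i, M.logRatio n h (y i))
    have h2 : 0 ≤ exp (h * M.lam⁻¹) * |∑ i, M.logRatio n h (y i) - h * M.lam⁻¹| := by positivity
    simp only [hZ, limitZ, Set.indicator_of_mem hh]
    rcases abs_cases (exp (∑ i, M.logRatio n h (y i)) - exp (h * M.lam⁻¹)) with h3 | h3 <;>
      rw [h3.1] <;> linarith
  · simp only [Z_of_notMem M hh, limitZ, Set.indicator_of_notMem hh]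
    rw [sub_zero, abs_zero, zero_add]
    positivity

lemma lam_pos : 0 < M.lam :=
  inv_pos.2 (mul_pos (M.f_pos _ M.θ0_mem _) M.g_deriv_pos)

lemma upper_alt_pos {α : ℝ} (hα : α ∈ Set.Ioo (0 : ℝ) 1) : 0 < -M.lam * Real.log α :=
  mul_pos_of_neg_of_neg (neg_lt_zero.2 M.lam_pos) (Real.log_neg hα.1 hα.2)

lemma exp_neg_upper_alt {α : ℝ} (hα : 0 < α) :
    exp (-(-M.lam * Real.log α) * M.lam⁻¹) = α := by
  have h1 := M.lam_pos.ne'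
  have h2 : -(-M.lam * Real.log α) * M.lam⁻¹ = Real.log α := by field_simp
  rw [h2, Real.exp_log hα]

section Test

variable {n : ℕ} {α Mc ε : ℝ}

lemma phiTS_mem_Icc (y : Fin n → ℝ) : M.phiTS n α Mc ε y ∈ Set.Icc (0 : ℝ) 1 := by
  rw [phiTS]
  split_ifs <;> norm_num

lemma notMem_above_zero_iff {y : Fin n → ℝ} : y ∉ M.above n 0 ↔ ∃ i, y i < M.g M.θ0 := by
  simp [above]

lemma phiTS_of_notMem {y : Fin n → ℝ} (hy : y ∉ M.above n 0) : M.phiTS n α Mc ε y = 1 :=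
  if_pos (Or.inr (Or.inr (M.notMem_above_zero_iff.1 hy)))

lemma measurable_phiTS (hp : M.θ0 + -M.lam * Real.log α / n ∈ M.N) (hm : M.θ0 + -Mc / n ∈ M.N) :
    Measurable (M.phiTS n α Mc ε) := by
  have heq : (M.above n 0)ᶜ = {y | ∃ i, y i < M.g M.θ0} :=
    Set.ext fun _ => M.notMem_above_zero_iff
  have hmeas := (M.measurableSet_above n 0).compl
  rw [heq] at hmeas
  exact Measurable.ite ((measurableSet_le measurable_const (M.measurable_Z hp)).union
    ((measurableSet_lt measurable_const (M.measurable_Z hm)).union hmeas))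
    measurable_const measurable_const

lemma phiTS_le (hε : ε ∈ Set.Ioo (0 : ℝ) 1) {y : Fin n → ℝ} (hy : y ∈ M.above n 0) :
    M.phiTS n α Mc ε y ≤ (M.above n (-M.lam * Real.log α)).indicator (fun _ => 1) y +
      (exp (-Mc * M.lam⁻¹) * ε)⁻¹ * |M.Z n 0 (-Mc) y - M.limitZ n (-Mc) y| := by
  have hpos : 0 < exp (-Mc * M.lam⁻¹) * ε := mul_pos (exp_pos _) hε.1
  have hind : 0 ≤ (M.above n (-M.lam * Real.log α)).indicator (fun _ => (1 : ℝ)) y :=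
    Set.indicator_nonneg (fun _ _ => zero_le_one) y
  by_cases hp : y ∈ M.above n (-M.lam * Real.log α)
  · rw [Set.indicator_of_mem hp]
    have h1 : 0 ≤ (exp (-Mc * M.lam⁻¹) * ε)⁻¹ * |M.Z n 0 (-Mc) y - M.limitZ n (-Mc) y| := by
      positivity
    linarith [(M.phiTS_mem_Icc (α := α) (Mc := Mc) (ε := ε) y).2]
  · rw [phiTS]
    split_ifs with h
    · rw [Z_of_notMem M hp] at h
      rcases h with h | h | h
      · exact absurd h (not_le.2 (mul_pos (exp_pos _) (by linarith [hε.2])))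
      · rw [div_eq_mul_inv] at h
        have h1 : exp (-Mc * M.lam⁻¹) * ε ≤ |M.Z n 0 (-Mc) y - M.limitZ n (-Mc) y| := by
          linarith [M.limitZ_le n (-Mc) y, le_abs_self (M.Z n 0 (-Mc) y - M.limitZ n (-Mc) y)]
        have h2 := mul_le_mul_of_nonneg_left h1 (inv_pos.2 hpos).le
        rw [inv_mul_cancel₀ hpos.ne'] at h2
        linarith
      · exact absurd hy (M.notMem_above_zero_iff.2 h)
    · positivity

lemma indicator_le_phiTS (hε : 0 < ε) (y : Fin n → ℝ) :
    (M.above n (-M.lam * Real.log α)).indicator (fun _ => 1) y ≤ M.phiTS n α Mc ε y +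
      (exp (-M.lam * Real.log α * M.lam⁻¹) * ε)⁻¹ *
        |M.Z n 0 (-M.lam * Real.log α) y - M.limitZ n (-M.lam * Real.log α) y| := by
  have hpos : 0 < exp (-M.lam * Real.log α * M.lam⁻¹) * ε := mul_pos (exp_pos _) hε
  by_cases hp : y ∈ M.above n (-M.lam * Real.log α)
  · rw [Set.indicator_of_mem hp, phiTS]
    split_ifs with h
    · linarith [mul_nonneg (inv_pos.2 hpos).le
        (abs_nonneg (M.Z n 0 (-M.lam * Real.log α) y - M.limitZ n (-M.lam * Real.log α) y))]
    · rw [limitZ, Set.indicator_of_mem hp]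
      have h1 := not_le.1 (not_or.1 h).1
      rw [div_eq_mul_inv] at h1
      have h2 := neg_abs_le (M.Z n 0 (-M.lam * Real.log α) y -
        exp (-M.lam * Real.log α * M.lam⁻¹))
      have h3 : exp (-M.lam * Real.log α * M.lam⁻¹) * ε ≤
          |M.Z n 0 (-M.lam * Real.log α) y - exp (-M.lam * Real.log α * M.lam⁻¹)| := by
        linarith
      have h4 := mul_le_mul_of_nonneg_left h3 (inv_pos.2 hpos).le
      rw [inv_mul_cancel₀ hpos.ne'] at h4
      linarith
  · rw [Set.indicator_of_notMem hp]
    linarith [(M.phiTS_mem_Icc (α := α) (Mc := Mc) (ε := ε) y).1, mul_nonneg (inv_pos.2 hpos).le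
      (abs_nonneg (M.Z n 0 (-M.lam * Real.log α) y - M.limitZ n (-M.lam * Real.log α) y))]

lemma integrable_of_mem_Icc {ψ : (Fin n → ℝ) → ℝ} (hψ : Measurable ψ)
    (hψ01 : ∀ y, ψ y ∈ Set.Icc (0 : ℝ) 1) (μ : Measure (Fin n → ℝ)) [IsFiniteMeasure μ] :
    Integrable ψ μ :=
  Integrable.of_bound hψ.aestronglyMeasurable 1 (Eventually.of_forall fun y => by
    rw [Real.norm_eq_abs, abs_of_nonneg (hψ01 y).1]
    exact (hψ01 y).2)

lemma integral_mem_Icc {ψ : (Fin n → ℝ) → ℝ} (hψ01 : ∀ y, ψ y ∈ Set.Icc (0 : ℝ) 1)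
    (θ : ℝ) : ∫ y, ψ y ∂M.P n θ ∈ Set.Icc (0 : ℝ) 1 := by
  refine ⟨integral_nonneg fun y => (hψ01 y).1, ?_⟩
  have h1 := integral_mono_of_nonneg (μ := M.P n θ) (Eventually.of_forall fun y => (hψ01 y).1)
    (integrable_const 1) (Eventually.of_forall fun y => (hψ01 y).2)
  simpa using h1

/-- On the support of the null law, the power of a test is governed by the limiting likelihood
ratio. -/
lemma abs_setIntegral_above_sub_le {h : ℝ} (hn : M.θ0 + h / n ∈ M.N) {ψ : (Fin n → ℝ) → ℝ}
    (hψ : Measurable ψ) (hψ01 : ∀ y, ψ y ∈ Set.Icc (0 : ℝ) 1) :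
    |∫ y in M.above n 0, ψ y ∂M.P n (M.θ0 + h / n) - ∫ y, M.limitZ n h y * ψ y ∂M.P n M.θ0| ≤
      ∫ y, |M.Z n 0 h y - M.limitZ n h y| ∂M.P n M.θ0 := by
  have hbd : ∀ᵐ y ∂M.P n M.θ0, ‖ψ y‖ ≤ 1 := Eventually.of_forall fun y => by
    rw [Real.norm_eq_abs, abs_of_nonneg (hψ01 y).1]
    exact (hψ01 y).2
  rw [setIntegral_above M hn, ← integral_sub
    ((M.integrable_Z hn).mul_bdd hψ.aestronglyMeasurable hbd)
    ((M.integrable_limitZ n h).mul_bdd hψ.aestronglyMeasurable hbd)]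
  refine abs_integral_le_integral_abs.trans (integral_mono_of_nonneg
    (Eventually.of_forall fun y => abs_nonneg _)
    ((M.integrable_Z hn).sub (M.integrable_limitZ n h)).abs (Eventually.of_forall fun y => ?_))
  dsimp only
  rw [← sub_mul, abs_mul, abs_of_nonneg (hψ01 y).1]
  exact mul_le_of_le_one_right (abs_nonneg _) (hψ01 y).2

lemma integral_alt_le {h : ℝ} (hn : M.θ0 + h / n ∈ M.N) {ψ : (Fin n → ℝ) → ℝ}
    (hψ : Measurable ψ) (hψ01 : ∀ y, ψ y ∈ Set.Icc (0 : ℝ) 1) :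
    ∫ y, ψ y ∂M.P n (M.θ0 + h / n) ≤ exp (h * M.lam⁻¹) * ∫ y, ψ y ∂M.P n M.θ0 +
      (∫ y, |M.Z n 0 h y - M.limitZ n h y| ∂M.P n M.θ0 +
        (1 - (M.P n (M.θ0 + h / n)).real (M.above n 0))) := by
  have h1 := (abs_le.1 (M.abs_setIntegral_above_sub_le hn hψ hψ01)).2
  have h2 : ∫ y, M.limitZ n h y * ψ y ∂M.P n M.θ0 ≤
      exp (h * M.lam⁻¹) * ∫ y, ψ y ∂M.P n M.θ0 := by
    rw [← integral_const_mul]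
    exact integral_mono_of_nonneg
      (Eventually.of_forall fun y => mul_nonneg (M.limitZ_nonneg n h y) (hψ01 y).1)
      ((integrable_of_mem_Icc hψ hψ01 _).const_mul _)
      (Eventually.of_forall fun y => mul_le_mul_of_nonneg_right (M.limitZ_le n h y) (hψ01 y).1)
  have h3 : ∫ y in (M.above n 0)ᶜ, ψ y ∂M.P n (M.θ0 + h / n) ≤
      1 - (M.P n (M.θ0 + h / n)).real (M.above n 0) := by
    rw [← probReal_compl_eq_one_sub (M.measurableSet_above n 0)]
    have h4 := integral_mono_of_nonneg (μ := (M.P n (M.θ0 + h / n)).restrict (M.above n 0)ᶜ)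
      (Eventually.of_forall fun y => (hψ01 y).1) (integrable_const 1)
      (Eventually.of_forall fun y => (hψ01 y).2)
    simpa using h4
  rw [← integral_add_compl (M.measurableSet_above n 0) (integrable_of_mem_Icc hψ hψ01 _)]
  linarith

lemma le_integral_alt {h : ℝ} (hn : M.θ0 + h / n ∈ M.N) {ψ : (Fin n → ℝ) → ℝ}
    (hψ : Measurable ψ) (hψ01 : ∀ y, ψ y ∈ Set.Icc (0 : ℝ) 1)
    (hψ1 : ∀ y, y ∉ M.above n 0 → ψ y = 1) :
    ∫ y, M.limitZ n h y * ψ y ∂M.P n M.θ0 - ∫ y, |M.Z n 0 h y - M.limitZ n h y| ∂M.P n M.θ0 +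
      (1 - (M.P n (M.θ0 + h / n)).real (M.above n 0)) ≤ ∫ y, ψ y ∂M.P n (M.θ0 + h / n) := by
  have h1 := (abs_le.1 (M.abs_setIntegral_above_sub_le hn hψ hψ01)).1
  have h3 : ∫ y in (M.above n 0)ᶜ, ψ y ∂M.P n (M.θ0 + h / n) =
      1 - (M.P n (M.θ0 + h / n)).real (M.above n 0) := by
    rw [← probReal_compl_eq_one_sub (M.measurableSet_above n 0),
      setIntegral_congr_fun (M.measurableSet_above n 0).compl fun y hy => hψ1 y hy]
    simp
  rw [← integral_add_compl (M.measurableSet_above n 0) (integrable_of_mem_Icc hψ hψ01 _)]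
  linarith

lemma size_phiTS_le (hε : ε ∈ Set.Ioo (0 : ℝ) 1) (hm : M.θ0 + -Mc / n ∈ M.N) :
    ∫ y, M.phiTS n α Mc ε y ∂M.P n M.θ0 ≤
      (M.P n M.θ0).real (M.above n (-M.lam * Real.log α)) + (exp (-Mc * M.lam⁻¹) * ε)⁻¹ *
        ∫ y, |M.Z n 0 (-Mc) y - M.limitZ n (-Mc) y| ∂M.P n M.θ0 := by
  have hI := (((M.integrable_Z hm).sub (M.integrable_limitZ n (-Mc))).abs).const_mul
    (exp (-Mc * M.lam⁻¹) * ε)⁻¹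
  have hA := M.measurableSet_above n (-M.lam * Real.log α)
  have hJ : Integrable ((M.above n (-M.lam * Real.log α)).indicator fun _ => (1 : ℝ))
      (M.P n M.θ0) := (integrable_const 1).indicator hA
  have h1 := integral_mono_of_nonneg (μ := M.P n M.θ0)
    (Eventually.of_forall fun y => (M.phiTS_mem_Icc (α := α) (Mc := Mc) (ε := ε) y).1)
    (hJ.add hI) ((M.ae_mem_above_zero n).mono fun y hy => M.phiTS_le hε hy)
  refine h1.trans_eq ?_
  rw [integral_add' hJ hI, integral_const_mul, integral_indicator hA]
  simp

lemma limitZ_mul_phiTS_ge (hε : 0 < ε) (hp : M.θ0 + -M.lam * Real.log α / n ∈ M.N)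
    (hm : M.θ0 + -Mc / n ∈ M.N) {h k : ℝ} (hk : M.above n k ⊆ M.above n h)
    (hk' : M.above n k ⊆ M.above n (-M.lam * Real.log α)) :
    exp (h * M.lam⁻¹) * ((M.P n M.θ0).real (M.above n k) -
        (exp (-M.lam * Real.log α * M.lam⁻¹) * ε)⁻¹ *
          ∫ y, |M.Z n 0 (-M.lam * Real.log α) y - M.limitZ n (-M.lam * Real.log α) y|
            ∂M.P n M.θ0) ≤
      ∫ y, M.limitZ n h y * M.phiTS n α Mc ε y ∂M.P n M.θ0 := by
  have hI := (((M.integrable_Z hp).sub (M.integrable_limitZ n (-M.lam * Real.log α))).abs).const_mul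
    (exp (-M.lam * Real.log α * M.lam⁻¹) * ε)⁻¹
  have hA := M.measurableSet_above n k
  have hJ : Integrable ((M.above n k).indicator fun _ => (1 : ℝ))
      (M.P n M.θ0) := (integrable_const 1).indicator hA
  have hφ := M.measurable_phiTS (ε := ε) hp hm
  have hK : Integrable (fun y => M.limitZ n h y * M.phiTS n α Mc ε y) (M.P n M.θ0) :=
    (M.integrable_limitZ n h).mul_bdd (c := 1) hφ.aestronglyMeasurable
      (Eventually.of_forall fun y => by
        rw [Real.norm_eq_abs, abs_of_nonneg (M.phiTS_mem_Icc y).1]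
        exact (M.phiTS_mem_Icc y).2)
  have h1 := integral_mono (μ := M.P n M.θ0) ((hJ.sub hI).const_mul (exp (h * M.lam⁻¹))) hK
    fun y => ?_
  · refine le_trans (le_of_eq ?_) h1
    rw [integral_const_mul, integral_sub' hJ hI, integral_const_mul, integral_indicator hA]
    simp
  · have h2 := M.indicator_le_phiTS (α := α) (Mc := Mc) hε y
    have h3 : 0 ≤ (exp (-M.lam * Real.log α * M.lam⁻¹) * ε)⁻¹ *
        |M.Z n 0 (-M.lam * Real.log α) y - M.limitZ n (-M.lam * Real.log α) y| := by positivity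
    have h4 := (M.phiTS_mem_Icc (α := α) (Mc := Mc) (ε := ε) y).1
    simp only [Pi.sub_apply]
    by_cases hy : y ∈ M.above n k
    · rw [Set.indicator_of_mem (hk' hy)] at h2
      rw [Set.indicator_of_mem hy,
        show M.limitZ n h y = exp (h * M.lam⁻¹) from Set.indicator_of_mem (hk hy) _]
      exact mul_le_mul_of_nonneg_left (by linarith) (exp_pos _).le
    · rw [Set.indicator_of_notMem hy]
      exact (mul_nonpos_of_nonneg_of_nonpos (exp_pos _).le (by linarith)).trans
        (mul_nonneg (M.limitZ_nonneg n h y) h4)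

end Test

lemma eventually_above_subset {h k : ℝ} (hhk : h ≤ k) :
    ∀ᶠ n : ℕ in atTop, M.above n k ⊆ M.above n h :=
  (M.eventually_g_le hhk).mono fun _ hn _ hy i => hn.trans (hy i)

lemma limsup_size_phiTS_le {α Mc ε : ℝ} (hα : α ∈ Set.Ioo (0 : ℝ) 1)
    (hε : ε ∈ Set.Ioo (0 : ℝ) 1) :
    limsup (fun n : ℕ => ∫ y, M.phiTS n α Mc ε y ∂M.P n M.θ0) atTop ≤ α := by
  have hlim := (M.tendsto_null_above (-M.lam * Real.log α)).add
    ((M.tendsto_Z_sub_limitZ (-Mc)).const_mul (exp (-Mc * M.lam⁻¹) * ε)⁻¹)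
  rw [max_eq_left (M.upper_alt_pos hα).le, exp_neg_upper_alt M hα.1, mul_zero, add_zero] at hlim
  refine le_of_le_of_eq ?_ hlim.limsup_eq
  refine limsup_le_limsup ((M.eventually_mem_N (-Mc)).mono fun n hn => M.size_phiTS_le hε hn) ?_
    hlim.isBoundedUnder_le
  exact (isBoundedUnder_of ⟨0, fun n => (M.integral_mem_Icc M.phiTS_mem_Icc _).1⟩ :
    IsBoundedUnder (· ≥ ·) atTop _).isCoboundedUnder_le

lemma le_liminf_power_phiTS {α Mc ε : ℝ} (hε : 0 < ε) (h : ℝ) :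
    exp (h * M.lam⁻¹) * exp (-(max (max h (-M.lam * Real.log α)) 0) * M.lam⁻¹) +
        (1 - exp (-(max (-h) 0) * M.lam⁻¹)) ≤
      liminf (fun n : ℕ => ∫ y, M.phiTS n α Mc ε y ∂M.P n (M.θ0 + h / n)) atTop := by
  have hlim := ((((M.tendsto_null_above (max h (-M.lam * Real.log α))).sub
    ((M.tendsto_Z_sub_limitZ (-M.lam * Real.log α)).const_mul
      (exp (-M.lam * Real.log α * M.lam⁻¹) * ε)⁻¹)).const_mul (exp (h * M.lam⁻¹))).sub
    (M.tendsto_Z_sub_limitZ h)).add ((M.tendsto_alt_above h).const_sub 1)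
  rw [mul_zero, sub_zero, sub_zero] at hlim
  rw [← hlim.liminf_eq]
  refine liminf_le_liminf ?_ hlim.isBoundedUnder_ge ?_
  · filter_upwards [M.eventually_mem_N h, M.eventually_mem_N (-Mc),
      M.eventually_mem_N (-M.lam * Real.log α), M.eventually_above_subset (le_max_left h _),
      M.eventually_above_subset (le_max_right h (-M.lam * Real.log α))] with n hn hm hp hs hs'
    have h1 := M.limitZ_mul_phiTS_ge hε hp hm hs hs'
    have h2 := M.le_integral_alt hn (M.measurable_phiTS (ε := ε) hp hm) M.phiTS_mem_Icc
      fun y hy => M.phiTS_of_notMem hy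
    linarith
  · exact (isBoundedUnder_of ⟨1, fun n => (M.integral_mem_Icc M.phiTS_mem_Icc _).2⟩ :
      IsBoundedUnder (· ≤ ·) atTop _).isCoboundedUnder_ge

lemma limsup_power_le {α : ℝ} {ψ : (n : ℕ) → (Fin n → ℝ) → ℝ} (hψ : ∀ n, Measurable (ψ n))
    (hψ01 : ∀ n y, ψ n y ∈ Set.Icc (0 : ℝ) 1)
    (hsize : limsup (fun n : ℕ => ∫ y, ψ n y ∂M.P n M.θ0) atTop ≤ α) (h : ℝ) :
    limsup (fun n : ℕ => ∫ y, ψ n y ∂M.P n (M.θ0 + h / n)) atTop ≤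
      exp (h * M.lam⁻¹) * α + (1 - exp (-(max (-h) 0) * M.lam⁻¹)) := by
  have hw := (M.tendsto_Z_sub_limitZ h).add ((M.tendsto_alt_above h).const_sub 1)
  rw [zero_add] at hw
  have hlim : Tendsto (fun a : ℝ => exp (h * M.lam⁻¹) * a +
      (1 - exp (-(max (-h) 0) * M.lam⁻¹))) (𝓝[>] α) (𝓝 _) :=
    (((continuous_const.mul continuous_id).add continuous_const).tendsto α).mono_left
      nhdsWithin_le_nhds
  refine ge_of_tendsto hlim ?_
  filter_upwards [self_mem_nhdsWithin] with a ha
  have hlt : ∀ᶠ n : ℕ in atTop, ∫ y, ψ n y ∂M.P n M.θ0 < a :=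
    eventually_lt_of_limsup_lt (hsize.trans_lt ha)
      (isBoundedUnder_of ⟨1, fun n => (M.integral_mem_Icc (hψ01 n) _).2⟩)
  have hw' := hw.const_add (exp (h * M.lam⁻¹) * a)
  rw [← hw'.limsup_eq]
  refine limsup_le_limsup ?_ ?_ hw'.isBoundedUnder_le
  · filter_upwards [hlt, M.eventually_mem_N h] with n hn hN
    have h1 := mul_le_mul_of_nonneg_left hn.le (exp_pos (h * M.lam⁻¹)).le
    linarith [M.integral_alt_le hN (hψ n) (hψ01 n)]
  · exact (isBoundedUnder_of ⟨0, fun n => (M.integral_mem_Icc (hψ01 n) _).1⟩ :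
      IsBoundedUnder (· ≥ ·) atTop _).isCoboundedUnder_le

lemma limsup_power_le_one {ψ : (n : ℕ) → (Fin n → ℝ) → ℝ}
    (hψ01 : ∀ n y, ψ n y ∈ Set.Icc (0 : ℝ) 1) (h : ℝ) :
    limsup (fun n : ℕ => ∫ y, ψ n y ∂M.P n (M.θ0 + h / n)) atTop ≤ 1 :=
  limsup_le_of_le ((isBoundedUnder_of ⟨0, fun n => (M.integral_mem_Icc (hψ01 n) _).1⟩ :
      IsBoundedUnder (· ≥ ·) atTop _).isCoboundedUnder_le)
    (Eventually.of_forall fun n => (M.integral_mem_Icc (hψ01 n) _).2)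

/-- Theorem 3: the two-sided NLR test is asymptotically uniformly most powerful at
level `α` over local alternatives in `[−M, 0) ∪ (0, ∞)`. -/
theorem nlr_ts_AUMP (M : BenchmarkModel) (α Mc ε : ℝ) (hα : α ∈ Set.Ioo (0 : ℝ) 1)
    (hMc : 0 < Mc) (hε : ε ∈ Set.Ioo (0 : ℝ) 1) :
    Filter.limsup (fun n : ℕ => ∫ y, M.phiTS n α Mc ε y ∂ M.P n M.θ0) atTop ≤ α ∧
    ∀ ψ : (n : ℕ) → (Fin n → ℝ) → ℝ,
      (∀ n, Measurable (ψ n)) → (∀ n y, ψ n y ∈ Set.Icc (0 : ℝ) 1) →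
      Filter.limsup (fun n : ℕ => ∫ y, ψ n y ∂ M.P n M.θ0) atTop ≤ α →
      ∀ h : ℝ, h ∈ Set.Ico (-Mc) 0 ∨ 0 < h →
        Filter.limsup (fun n : ℕ => ∫ y, ψ n y ∂ M.P n (M.θ0 + h / n)) atTop ≤
          Filter.liminf
            (fun n : ℕ => ∫ y, M.phiTS n α Mc ε y ∂ M.P n (M.θ0 + h / n)) atTop := by
  refine ⟨M.limsup_size_phiTS_le hα hε, fun ψ hψ hψ01 hsize h _ => ?_⟩
  refine le_trans ?_ (M.le_liminf_power_phiTS hε.1 h)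
  have hpos := M.upper_alt_pos hα
  rcases le_total h (-M.lam * Real.log α) with hle | hle
  · rw [max_eq_right hle, max_eq_left hpos.le, exp_neg_upper_alt M hα.1]
    exact M.limsup_power_le hψ hψ01 hsize h
  · have h0 : 0 ≤ h := hpos.le.trans hle
    rw [max_eq_left hle, max_eq_left h0, max_eq_right (neg_nonpos.2 h0), ← Real.exp_add]
    simpa using M.limsup_power_le_one hψ01 h

end BenchmarkModel
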